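/- Let M be a positive even integer. For all integers u, v with 0 ≤ u, v < M, the following finite-sum identity holds in ℂ: (1/√M) · exp(−i·π/4) · exp(i·π·(u − v)^2 / M) = (1/M) · ∑_{m=0}^{M−1} exp(−i·π·m^2 / M) · exp(2·π·i·m·(u − v) / M). -/

import Mathlib

open Complex Finset

open Filter Topology in
/-- The cosine kernel tends to `1` at `+∞`. -/
theorem tendsto_cosKernel_atTop (a : UnitAddCircle) :
    Tendsto (HurwitzZeta.cosKernel a) atTop (𝓝 1) := by
  obtain ⟨p, hp, h⟩ := HurwitzZeta.isBigO_atTop_cosKernel_sub a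
  have h0 : Tendsto (fun x : ℝ ↦ Real.exp (-p * x)) atTop (𝓝 0) :=
    Real.tendsto_exp_atBot.comp (tendsto_id.const_mul_atTop_of_neg (neg_neg_of_pos hp))
  simpa using (h.trans_tendsto h0).add_const 1

open Filter Topology in
/-- Jacobi's theta function tends to `1` at `i∞`. -/
theorem tendsto_jacobiTheta_im_atTop : Tendsto jacobiTheta (comap im atTop) (𝓝 1) := by
  have h0 : Tendsto (fun τ : ℂ ↦ Real.exp (-Real.pi * τ.im)) (comap im atTop) (𝓝 0) :=
    Real.tendsto_exp_atBot.comp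
      (tendsto_comap.const_mul_atTop_of_neg (neg_neg_of_pos Real.pi_pos))
  simpa using (isBigO_at_im_infty_jacobiTheta_sub_one.trans_tendsto h0).add_const 1

theorem exp_neg_pi_mul_I_mul_sq_div_add {M : ℕ} (hM : 0 < M) (hMeven : Even M) (a k : ℤ) :
    cexp (-Real.pi * I * (k * M + a : ℂ) ^ 2 / M) = cexp (-Real.pi * I * (a : ℂ) ^ 2 / M) := by
  obtain ⟨r, hr⟩ := hMeven
  have hM0 : (M : ℂ) ≠ 0 := by exact_mod_cast hM.ne'
  rw [Complex.exp_eq_exp_iff_exists_int]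
  refine ⟨-(k ^ 2 * r + k * a), ?_⟩
  have hr' : (M : ℂ) = 2 * r := by rw [hr]; push_cast; ring
  field_simp
  push_cast
  rw [hr']
  ring

theorem jacobiTheta_neg_inv {τ : ℂ} (hτ : 0 < τ.im) :
    jacobiTheta (-1 / τ) = (-I * τ) ^ (1 / 2 : ℂ) * jacobiTheta τ := by
  have := jacobiTheta_S_smul ⟨τ, hτ⟩
  rw [UpperHalfPlane.modular_S_smul] at this
  simpa [neg_div, inv_neg] using this

theorem jacobiTheta_add_even {M : ℕ} (hMeven : Even M) (τ : ℂ) :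
    jacobiTheta (τ + M) = jacobiTheta τ := by
  obtain ⟨r, rfl⟩ := hMeven
  induction r with
  | zero => simp
  | succ r ih =>
    rw [← ih, ← jacobiTheta_two_add (τ + (r + r : ℕ))]
    congr 1
    push_cast
    ring

open HurwitzZeta in
theorem jacobiTheta_eq_sum_evenKernel {M : ℕ} (hM : 0 < M) (hMeven : Even M) (d : ℤ) {x : ℝ}
    (hx : 0 < x) :
    jacobiTheta (I * (x / M ^ 2) - 1 / M) = ∑ m ∈ range M,
      cexp (-Real.pi * I * (m - d : ℂ) ^ 2 / M) *
        evenKernel (((m - d) / M : ℝ) : UnitAddCircle) x := by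
  have : NeZero M := ⟨hM.ne'⟩
  have hM0 : (M : ℂ) ≠ 0 := by exact_mod_cast hM.ne'
  set τ : ℂ := I * (x / M ^ 2) - 1 / M with hτ
  have him : 0 < τ.im := by
    have : τ.im = x / M ^ 2 := by
      have : τ = ((-1 / M : ℝ) : ℂ) + ((x / M ^ 2 : ℝ) : ℂ) * I := by rw [hτ]; push_cast; ring
      rw [this]; simp [-ofReal_div]
    rw [this]; positivity
  have hs : Summable fun n : ℤ ↦ cexp (Real.pi * I * (n : ℂ) ^ 2 * τ) := by
    simpa [jacobiTheta₂_term] using (hasSum_jacobiTheta₂_term 0 him).summable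
  obtain ⟨e, he⟩ : ∃ e : Fin M × ℤ ≃ ℤ, ∀ m k, e (m, k) = k * M + (m - d) :=
    ⟨((Equiv.prodComm _ _).trans (Int.divModEquiv M).symm).trans (Equiv.subRight d),
      fun m k ↦ by simp [Int.divModEquiv]; ring⟩
  have hterm (m : Fin M) (k : ℤ) : cexp (Real.pi * I * (e (m, k) : ℂ) ^ 2 * τ) =
      cexp (-Real.pi * I * (m - d : ℂ) ^ 2 / M) *
        (Real.exp (-Real.pi * (k + (m - d) / M) ^ 2 * x) : ℝ) := by
    have := exp_neg_pi_mul_I_mul_sq_div_add hM hMeven (m - d) k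
    rw [he]
    push_cast at this ⊢
    rw [← this, ← Complex.exp_add]
    congr 1
    rw [hτ]
    field_simp
    linear_combination (k * M + (m - d) : ℂ) ^ 2 * x * I_sq
  have hs' : Summable fun p ↦ cexp (Real.pi * I * (e p : ℂ) ^ 2 * τ) := e.summable_iff.mpr hs
  rw [jacobiTheta, ← e.tsum_eq, hs'.tsum_prod, tsum_fintype,
    ← Fin.sum_univ_eq_sum_range fun m ↦ cexp (-Real.pi * I * (m - d : ℂ) ^ 2 / M) *
        evenKernel (((m - d) / M : ℝ) : UnitAddCircle) x]
  refine sum_congr rfl fun m _ ↦ ?_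
  simp_rw [hterm]
  rw [tsum_mul_left, ← ofReal_tsum, (hasSum_int_evenKernel _ hx).tsum_eq]

theorem real_mul_cpow {r : ℝ} (hr : 0 < r) {z : ℂ} (hz : z ≠ 0) (s : ℂ) :
    ((r : ℂ) * z) ^ s = (r : ℂ) ^ s * z ^ s := by
  have hr' : (r : ℂ) ≠ 0 := by exact_mod_cast hr.ne'
  rw [cpow_def_of_ne_zero (mul_ne_zero hr' hz), cpow_def_of_ne_zero hr', cpow_def_of_ne_zero hz,
    log_ofReal_mul hr hz, ofReal_log hr.le, add_mul, Complex.exp_add]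

theorem I_div_natCast_cpow_half {M : ℕ} (hM : 0 < M) :
    (I / M : ℂ) ^ (1 / 2 : ℂ) = cexp (I * Real.pi / 4) / Real.sqrt M := by
  have hM' : (0 : ℝ) < (M : ℝ)⁻¹ := by positivity
  have h : (I / M : ℂ) = (((M : ℝ)⁻¹ : ℝ) : ℂ) * I := by push_cast; ring
  rw [h, real_mul_cpow hM' I_ne_zero, cpow_def_of_ne_zero I_ne_zero, log_I,
    show (1 / 2 : ℂ) = ((1 / 2 : ℝ) : ℂ) by push_cast; rfl, ← ofReal_cpow hM'.le,
    ← Real.sqrt_eq_rpow, Real.sqrt_inv]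
  push_cast
  rw [div_eq_mul_inv, mul_comm]
  ring_nf

open HurwitzZeta in
theorem one_sub_cpow_mul_jacobiTheta {M : ℕ} (hM : 0 < M) (hMeven : Even M) (d : ℤ) {x : ℝ}
    (hx : 0 < x) :
    (1 - I / M * (x⁻¹ : ℝ)) ^ (1 / 2 : ℂ) * jacobiTheta (I * x + 1 / M) =
      ((x⁻¹ : ℝ) / M ^ 2 + I / M) ^ (1 / 2 : ℂ) * ∑ m ∈ range M,
        cexp (-Real.pi * I * (m - d : ℂ) ^ 2 / M) *
          cosKernel (((m - d) / M : ℝ) : UnitAddCircle) x := by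
  have hM0 : (M : ℂ) ≠ 0 := by exact_mod_cast hM.ne'
  have hx0 : (x : ℂ) ≠ 0 := by exact_mod_cast hx.ne'
  set ρ : ℂ := I * x + 1 / M with hρ
  set τ : ℂ := I * ((x⁻¹ : ℝ) / M ^ 2) - 1 / M with hτ
  have hρim : 0 < ρ.im := by
    have : ρ = ((1 / M : ℝ) : ℂ) + (x : ℂ) * I := by rw [hρ]; push_cast; ring
    rw [this]; simpa [-ofReal_div] using hx
  have hτim : 0 < τ.im := by
    have : τ = ((-1 / M : ℝ) : ℂ) + ((x⁻¹ / M ^ 2 : ℝ) : ℂ) * I := by rw [hτ]; push_cast; ring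
    rw [this]
    have : 0 < x⁻¹ / M ^ 2 := by positivity
    simpa [-ofReal_div] using this
  have hρ0 : ρ ≠ 0 := fun h ↦ by simp [h] at hρim
  have hτ0 : τ ≠ 0 := fun h ↦ by simp [h] at hτim
  have hinv : -1 / τ = -1 / ρ + M := by
    have : ρ * M - 1 = I * x * M := by rw [hρ]; field_simp; ring
    have hmul : -ρ = τ * (I * x * M) := by
      rw [hρ, hτ]; push_cast; field_simp; linear_combination -I_sq
    rw [← this] at hmul
    field_simp
    linear_combination hmul
  have key : (-I * ρ) ^ (1 / 2 : ℂ) * jacobiTheta ρ = (-I * τ) ^ (1 / 2 : ℂ) * jacobiTheta τ := by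
    rw [← jacobiTheta_neg_inv hρim, ← jacobiTheta_neg_inv hτim, hinv, jacobiTheta_add_even hMeven]
  have h1 : -I * ρ = (x : ℂ) * (1 - I / M * (x⁻¹ : ℝ)) := by
    rw [hρ]; push_cast; field_simp; linear_combination -M * x * I_sq
  have h2 : -I * τ = (x⁻¹ : ℝ) / M ^ 2 + I / M := by
    rw [hτ]; linear_combination -((x⁻¹ : ℝ) / M ^ 2 : ℂ) * I_sq
  have h1' : 1 - I / M * (x⁻¹ : ℝ) ≠ 0 := fun h ↦ by
    rw [h, mul_zero] at h1
    exact mul_ne_zero (neg_ne_zero.mpr I_ne_zero) hρ0 h1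
  have hxc : (x : ℂ) ^ (1 / 2 : ℂ) ≠ 0 := by simp [cpow_eq_zero_iff, hx0]
  rw [h1, real_mul_cpow hx h1', h2, jacobiTheta_eq_sum_evenKernel hM hMeven d (inv_pos.mpr hx)] at key
  refine mul_left_cancel₀ hxc ?_
  rw [← mul_assoc, key, mul_left_comm, mul_sum (a := (x : ℂ) ^ (1 / 2 : ℂ))]
  congr 1
  refine sum_congr rfl fun m _ ↦ ?_
  rw [evenKernel_functional_equation, Real.inv_rpow hx.le]
  simp [ofReal_cpow hx.le]
  ring

open Filter Topology HurwitzZeta in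
/-- A quadratic Gauss sum over a shifted complete residue system. -/
theorem sum_exp_neg_pi_mul_I_mul_sq_div {M : ℕ} (hM : 0 < M) (hMeven : Even M) (d : ℤ) :
    ∑ m ∈ range M, cexp (-Real.pi * I * (m - d : ℂ) ^ 2 / M) =
      Real.sqrt M * cexp (-I * Real.pi / 4) := by
  have hinv : Tendsto (fun x : ℝ ↦ ((x⁻¹ : ℝ) : ℂ)) atTop (𝓝 0) := by
    exact_mod_cast (continuous_ofReal.tendsto 0).comp tendsto_inv_atTop_zero
  have hl₁ : Tendsto (fun x : ℝ ↦ (1 - I / M * (x⁻¹ : ℝ)) ^ (1 / 2 : ℂ)) atTop (𝓝 1) := by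
    have : Tendsto (fun x : ℝ ↦ 1 - I / M * (x⁻¹ : ℝ)) atTop (𝓝 (1 : ℂ)) := by
      simpa using (hinv.const_mul (I / M)).const_sub 1
    simpa using this.cpow (tendsto_const_nhds (x := (1 / 2 : ℂ))) (by simp)
  have hl₂ : Tendsto (fun x : ℝ ↦ jacobiTheta (I * x + 1 / M)) atTop (𝓝 1) := by
    refine tendsto_jacobiTheta_im_atTop.comp (tendsto_comap_iff.mpr ?_)
    refine tendsto_id.congr fun x ↦ ?_
    have : I * x + 1 / M = ((1 / M : ℝ) : ℂ) + (x : ℂ) * I := by push_cast; ring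
    simp [this, -ofReal_div, -one_div]
  have hr₁ : Tendsto (fun x : ℝ ↦ ((x⁻¹ : ℝ) / M ^ 2 + I / M : ℂ) ^ (1 / 2 : ℂ)) atTop
      (𝓝 ((I / M) ^ (1 / 2 : ℂ))) := by
    refine Tendsto.cpow ?_ tendsto_const_nhds ?_
    · simpa using (hinv.div_const (M ^ 2 : ℂ)).add_const (I / M)
    · simp [mem_slitPlane_iff, hM.ne']
  have hr₂ : Tendsto (fun x : ℝ ↦ ∑ m ∈ range M, cexp (-Real.pi * I * (m - d : ℂ) ^ 2 / M) *
      cosKernel (((m - d) / M : ℝ) : UnitAddCircle) x) atTop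
      (𝓝 (∑ m ∈ range M, cexp (-Real.pi * I * (m - d : ℂ) ^ 2 / M))) := by
    refine tendsto_finsetSum _ fun m _ ↦ ?_
    simpa [-neg_mul] using ((continuous_ofReal.tendsto 1).comp
      (tendsto_cosKernel_atTop (((m - d) / M : ℝ) : UnitAddCircle))).const_mul
      (cexp (-Real.pi * I * (m - d : ℂ) ^ 2 / M))
  have hlim := tendsto_nhds_unique_of_eventuallyEq (hl₁.mul hl₂) (hr₁.mul hr₂)
    ((eventually_gt_atTop 0).mono fun x hx ↦ one_sub_cpow_mul_jacobiTheta hM hMeven d hx)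
  have hs : (Real.sqrt M : ℂ) ≠ 0 := by simpa using hM.ne'
  rw [I_div_natCast_cpow_half hM, one_mul] at hlim
  rw [show -I * Real.pi / 4 = -(I * Real.pi / 4) by ring, Complex.exp_neg]
  field_simp at hlim ⊢
  linear_combination -hlim

/-- Entrywise eigendecomposition of the discrete Fresnel transform (quadratic
Gauss-sum identity): for even `M` and `0 ≤ u, v < M`,
`(1/√M) e^{-iπ/4} e^{iπ(u-v)²/M} = (1/M) ∑_{m<M} e^{-iπm²/M} e^{2πim(u-v)/M}`. -/
theorem dfnt_eigendecomposition (M : ℕ) (hM : 0 < M) (hMeven : Even M)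
    (u v : ℤ) (hu : 0 ≤ u ∧ u < M) (hv : 0 ≤ v ∧ v < M) :
    (1 / (Real.sqrt M : ℂ)) * Complex.exp (-Complex.I * Real.pi / 4)
        * Complex.exp (Complex.I * Real.pi * ((u - v : ℤ) : ℂ) ^ 2 / M)
      = (1 / (M : ℂ)) * ∑ m ∈ Finset.range M,
          Complex.exp (-Complex.I * Real.pi * (m : ℂ) ^ 2 / M)
            * Complex.exp (2 * Real.pi * Complex.I * (m : ℂ) * ((u - v : ℤ) : ℂ) / M) := by
  have hs : (Real.sqrt M : ℂ) ≠ 0 := by simpa using hM.ne'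
  have hsq : (Real.sqrt M : ℂ) ^ 2 = M := by
    rw [← ofReal_pow, Real.sq_sqrt M.cast_nonneg, ofReal_natCast]
  have hterm (m : ℕ) : cexp (-I * Real.pi * (m : ℂ) ^ 2 / M) *
      cexp (2 * Real.pi * I * (m : ℂ) * ((u - v : ℤ) : ℂ) / M) =
      cexp (I * Real.pi * ((u - v : ℤ) : ℂ) ^ 2 / M) *
        cexp (-Real.pi * I * (m - (u - v : ℤ) : ℂ) ^ 2 / M) := by
    rw [← Complex.exp_add, ← Complex.exp_add]
    ring_nf
  simp_rw [hterm]
  rw [← mul_sum, sum_exp_neg_pi_mul_I_mul_sq_div hM hMeven, ← hsq]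
  field_simp
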